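/- arXiv:2603.12439 — 2 statements merged into one kernel-verified Lean document; each statement's English description precedes it below -/
import Mathlib

section
/- Let n, p ∈ ℕ, δ ≥ 0, and let g : C([−δ,0],ℝⁿ) × ℝᵖ → ℝⁿ be globally Lipschitz continuous with some constant L > 0 (i.e., ‖g(φ,u) − g(ψ,v)‖ ≤ L(‖φ−ψ‖_c + ‖u−v‖) for all φ, ψ, u, v) and g(0,0) = 0. Assume the zero-input system is globally exponentially stable: there exist a₁, a₂ > 0 such that every continuous x : [−δ,∞) → ℝⁿ differentiable on [0,∞) with x′(t) = g(x_t, 0) for all t ≥ 0 satisfies ‖x(t)‖ ≤ a₁‖x₀‖_c e^{−a₂ t} for all t ≥ 0. Then the system ẋ(t) = g(x_t, v(t)) is input-to-state stable: there exist a class-KL function β and a class-K function γ such that for every continuous bounded v : [0,∞) → ℝᵖ and every continuous x : [−δ,∞) → ℝⁿ differentiable on [0,∞) with x′(t) = g(x_t, v(t)) for all t ≥ 0, one has ‖x(t)‖ ≤ β(‖x₀‖_c, t) + γ( sup_{0≤s≤t} ‖v(s)‖ ) for all t ≥ 0. -/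
open Set Filter Topology

/-- The history segment `x_t ∈ C([-δ,0], E)` of a continuous function `x : ℝ → E`,
defined by `x_t(θ) = x(t+θ)` for `θ ∈ [-δ,0]`. -/
noncomputable def seg {E : Type*} [TopologicalSpace E] (δ : ℝ) (x : ℝ → E) (hx : Continuous x)
    (t : ℝ) : C(Set.Icc (-δ) (0:ℝ), E) :=
  ⟨fun θ => x (t + θ.1), hx.comp (continuous_const.add continuous_subtype_val)⟩

/-- A function `γ : [0,∞) → [0,∞)` is of class K if it is continuous, strictly
increasing and `γ(0) = 0`. -/
def ClassK (γ : ℝ → ℝ) : Prop :=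
  ContinuousOn γ (Set.Ici 0) ∧ StrictMonoOn γ (Set.Ici 0) ∧ γ 0 = 0

/-- A function `β : [0,∞) × [0,∞) → [0,∞)` is of class KL if `β(·,t)` is of class K
for each `t ≥ 0`, and `β(s,·)` is nonincreasing with limit `0` at `∞` for each `s ≥ 0`. -/
def ClassKL (β : ℝ → ℝ → ℝ) : Prop :=
  (∀ t, 0 ≤ t → ClassK fun s => β s t) ∧
  (∀ s, 0 ≤ s → AntitoneOn (β s) (Set.Ici 0) ∧ Filter.Tendsto (β s) Filter.atTop (nhds 0))


section helpers

set_option linter.unusedSectionVars false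

variable {E : Type*} [NormedAddCommGroup E] [NormedSpace ℝ E]

lemma seg_apply' (δ : ℝ) (x : ℝ → E) (hx : Continuous x) (t : ℝ) (θ : Set.Icc (-δ) (0:ℝ)) :
    seg δ x hx t θ = x (t + θ.1) := rfl

lemma seg_continuous (δ : ℝ) (x : ℝ → E) (hx : Continuous x) : Continuous (seg δ x hx) := by
  let F : C(ℝ × Set.Icc (-δ) (0:ℝ), E) :=
    ⟨fun q => x (q.1 + q.2.1), hx.comp (by fun_prop)⟩
  exact F.curry.continuous

lemma seg_norm_le (δ : ℝ) (x : ℝ → E) (hx : Continuous x) (t : ℝ) {M : ℝ} (hM : 0 ≤ M)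
    (h : ∀ r, t - δ ≤ r → r ≤ t → ‖x r‖ ≤ M) : ‖seg δ x hx t‖ ≤ M := by
  rw [ContinuousMap.norm_le _ hM]
  intro θ
  exact h _ (by linarith [θ.2.1]) (by linarith [θ.2.2])

lemma norm_le_seg (δ : ℝ) (x : ℝ → E) (hx : Continuous x) (t r : ℝ)
    (h1 : t - δ ≤ r) (h2 : r ≤ t) : ‖x r‖ ≤ ‖seg δ x hx t‖ := by
  have := (seg δ x hx t).norm_coe_le_norm ⟨r - t, by linarith, by linarith⟩
  rw [seg_apply'] at this
  simpa using this

lemma seg_shift (δ : ℝ) (x : ℝ → E) (hx : Continuous x) (s t : ℝ)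
    (hx' : Continuous fun r => x (s + r)) :
    seg δ (fun r => x (s + r)) hx' t = seg δ x hx (s + t) := by
  ext θ
  simp only [seg_apply', add_assoc]

noncomputable def gK (L δ T : ℝ) : ℝ :=
  Real.exp (2 * L * T) * (Real.exp (2 * L * δ) + 2 + 2 * L * T)

lemma gK_pos {L δ T : ℝ} (hL : 0 < L) (hT : 0 ≤ T) : 0 < gK L δ T := by
  unfold gK; positivity

/-- Gronwall inequality for delay systems. -/
lemma delay_gronwall {L δ T S V D : ℝ} (hL : 0 < L) (hδ : 0 ≤ δ) (hS : 0 ≤ S) (hST : S ≤ T)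
    (hV : 0 ≤ V) (hD : 0 ≤ D) (d d' : ℝ → E) (hd : Continuous d)
    (hder : ∀ t, 0 ≤ t → HasDerivAt d (d' t) t)
    (hb : ∀ t, 0 ≤ t → t ≤ S → ‖d' t‖ ≤ L * (‖seg δ d hd t‖ + V))
    (h0 : ‖seg δ d hd 0‖ ≤ D) :
    ∀ t, -δ ≤ t → t ≤ S → ‖d t‖ ≤ gK L δ T * (D + V) := by
  obtain ⟨τ, hτ, hmax⟩ := (isCompact_Icc (a := -δ) (b := S)).exists_isMaxOn
    ⟨0, by constructor <;> linarith⟩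
    (f := fun t => Real.exp (-(2 * L * t)) * ‖d t‖) (by fun_prop)
  set N := Real.exp (-(2 * L * τ)) * ‖d τ‖ with hN
  have hN0 : 0 ≤ N := by positivity
  have hdN : ∀ t, -δ ≤ t → t ≤ S → ‖d t‖ ≤ N * Real.exp (2 * L * t) := by
    intro t h1 h2
    have h : Real.exp (-(2 * L * t)) * ‖d t‖ ≤ N := hmax ⟨h1, h2⟩
    have := mul_le_mul_of_nonneg_right h (Real.exp_pos (2 * L * t)).le
    rw [mul_right_comm, ← Real.exp_add] at this
    simpa using this
  have hT : 0 ≤ T := hS.trans hST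
  have hNb : N ≤ Real.exp (2 * L * δ) * D + 2 * D + 2 * L * T * V := by
    rcases le_total τ 0 with h | h
    · have h1 : ‖d τ‖ ≤ D := (norm_le_seg δ d hd 0 τ (by linarith [hτ.1]) h).trans h0
      have h2 : Real.exp (-(2 * L * τ)) ≤ Real.exp (2 * L * δ) := by
        apply Real.exp_le_exp.2; nlinarith [hτ.1]
      have : N ≤ Real.exp (2 * L * δ) * D := by
        rw [hN]; gcongr
      have : 0 ≤ 2 * L * T * V := by positivity
      linarith
    · have key := image_norm_le_of_norm_deriv_right_le_deriv_boundary (f := d) (f' := d')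
        (a := 0) (b := S) (B := fun t => D + N / 2 * Real.exp (2 * L * t) + L * V * t)
        (B' := fun t => L * (N * Real.exp (2 * L * t) + V)) hd.continuousOn
        (fun t ht => (hder t ht.1).hasDerivWithinAt)
        (by
          have := (norm_le_seg δ d hd 0 0 (by linarith) le_rfl).trans h0
          simp; linarith)
        (fun t => by
          have := ((((hasDerivAt_id t).const_mul (2 * L)).exp).const_mul (N / 2)).const_add D
          have h2 := this.add ((hasDerivAt_id t).const_mul (L * V))
          refine h2.congr_deriv ?_
          simp; ring)
        (fun t ht => by
          refine (hb t ht.1 ht.2.le).trans ?_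
          gcongr
          apply seg_norm_le _ _ _ _ (by positivity)
          intro r h1 h2
          refine (hdN r (by linarith [ht.1]) (by linarith [ht.2])).trans ?_
          gcongr)
        (x := τ) ⟨h, hτ.2⟩
      have hE1 : Real.exp (-(2 * L * τ)) ≤ 1 := Real.exp_le_one_iff.2 (by
        have : 0 ≤ 2 * L * τ := by positivity
        linarith)
      have hE2 : Real.exp (-(2 * L * τ)) * Real.exp (2 * L * τ) = 1 := by
        rw [← Real.exp_add]; simp
      have h3 : N ≤ Real.exp (-(2 * L * τ)) * (D + N / 2 * Real.exp (2 * L * τ) + L * V * τ) := by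
        rw [hN] at *
        exact mul_le_mul_of_nonneg_left key (Real.exp_pos _).le
      have h4 : Real.exp (-(2 * L * τ)) * (D + N / 2 * Real.exp (2 * L * τ) + L * V * τ)
          = Real.exp (-(2 * L * τ)) * (D + L * V * τ) + N / 2 := by
        linear_combination (N / 2) * hE2
      have h5 : Real.exp (-(2 * L * τ)) * (D + L * V * τ) ≤ D + L * V * τ :=
        mul_le_of_le_one_left (by positivity) hE1
      have h6 : L * V * τ ≤ L * V * T := by
        gcongr; linarith [hτ.2]
      have : 0 ≤ Real.exp (2 * L * δ) * D := by positivity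
      linarith
  intro t h1 h2
  refine (hdN t h1 h2).trans ?_
  have h7 : N ≤ (Real.exp (2 * L * δ) + 2 + 2 * L * T) * (D + V) := by
    have : 0 ≤ (Real.exp (2 * L * δ) + 2) * V := by positivity
    have : 0 ≤ 2 * L * T * D := by positivity
    linarith
  calc N * Real.exp (2 * L * t) ≤ ((Real.exp (2 * L * δ) + 2 + 2 * L * T) * (D + V)) *
        Real.exp (2 * L * T) := by
        have : t ≤ T := h2.trans hST
        gcongr
    _ = _ := by unfold gK; ring

lemma norm_integral_exp_le [CompleteSpace E] {l A : ℝ} (hl : 0 < l) (hA : 0 ≤ A) (f : ℝ → E)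
    (hf : Continuous f) (hb : ∀ s, 0 ≤ s → ‖f s‖ ≤ A * Real.exp (l * s)) (t : ℝ) (ht : 0 ≤ t) :
    ‖∫ s in (0:ℝ)..t, f s‖ ≤ A / l * Real.exp (l * t) := by
  have hd : ∀ t, HasDerivAt (fun t => ∫ s in (0:ℝ)..t, f s) (f t) t := fun t =>
    intervalIntegral.integral_hasDerivAt_right (hf.intervalIntegrable _ _)
      (hf.stronglyMeasurableAtFilter _ _) hf.continuousAt
  exact image_norm_le_of_norm_deriv_right_le_deriv_boundary (a := 0) (b := t)
    (f := fun t => ∫ s in (0:ℝ)..t, f s) (f' := f)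
    (B := fun t => A / l * Real.exp (l * t)) (B' := fun t => A * Real.exp (l * t))
    (fun t _ => (hd t).continuousAt.continuousWithinAt)
    (fun t _ => (hd t).hasDerivWithinAt)
    (by simp; positivity)
    (fun t => by
      have := (((hasDerivAt_id t).const_mul l).exp).const_mul (A / l)
      refine this.congr_deriv ?_
      simp; field_simp)
    (fun t ht => hb t ht.1) (x := t) ⟨ht, le_rfl⟩

open scoped BoundedContinuousFunction in
/-- Global existence for the delay system. -/
lemma delay_exists [CompleteSpace E] {L δ : ℝ} (hL : 0 < L)
    (f : C(Set.Icc (-δ) (0:ℝ), E) → E) (hf : ∀ a b, ‖f a - f b‖ ≤ L * ‖a - b‖)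
    (φ : ℝ → E) (hφ : Continuous φ) :
    ∃ (y : ℝ → E) (hy : Continuous y), (∀ t, t ≤ 0 → y t = φ t) ∧
      (∀ t, 0 ≤ t → y t = φ 0 + ∫ s in (0:ℝ)..t, f (seg δ y hy s)) := by
  have hfc : Continuous f := by
    have : LipschitzWith ⟨L, hL.le⟩ f := LipschitzWith.of_dist_le_mul fun a b => by
      rw [dist_eq_norm, dist_eq_norm]; exact hf a b
    exact this.continuous
  let Y : (ℝ →ᵇ E) → ℝ → E := fun w t => φ (min t 0) + Real.exp (2 * L * t) • w t
  have hY : ∀ w, Continuous (Y w) := fun w => by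
    have := w.continuous
    fun_prop
  have hint : ∀ w, Continuous fun s => f (seg δ (Y w) (hY w) s) := fun w =>
    hfc.comp (seg_continuous _ _ _)
  let J : (ℝ →ᵇ E) → ℝ → E := fun w t => ∫ s in (0:ℝ)..t, f (seg δ (Y w) (hY w) s)
  have hJ : ∀ w, Continuous (J w) := fun w =>
    intervalIntegral.continuous_primitive (fun a b => (hint w).intervalIntegrable a b) 0
  obtain ⟨B, hB⟩ := (isCompact_Icc (a := -δ) (b := 0)).exists_bound_of_continuousOn
    hφ.continuousOn
  set A := ‖f 0‖ + L * |B| with hA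
  have hbound : ∀ w : ℝ →ᵇ E, ∀ s, 0 ≤ s →
      ‖f (seg δ (Y w) (hY w) s)‖ ≤ (A + L * ‖w‖) * Real.exp (2 * L * s) := by
    intro w s hs
    have h1 : ‖seg δ (Y w) (hY w) s‖ ≤ |B| + Real.exp (2 * L * s) * ‖w‖ := by
      apply seg_norm_le _ _ _ _ (by positivity)
      intro r h1 h2
      refine (norm_add_le _ _).trans ?_
      apply add_le_add
      · refine (hB _ ⟨?_, min_le_right _ _⟩).trans (le_abs_self _)
        apply le_min <;> linarith
      · rw [norm_smul, Real.norm_eq_abs, Real.abs_exp]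
        gcongr
        exact w.norm_coe_le_norm r
    have h2 : ‖f (seg δ (Y w) (hY w) s)‖ ≤ ‖f 0‖ + L * ‖seg δ (Y w) (hY w) s‖ := by
      have := hf (seg δ (Y w) (hY w) s) 0
      rw [sub_zero] at this
      have h3 := norm_sub_norm_le (f (seg δ (Y w) (hY w) s)) (f 0)
      linarith
    have h3 : 1 ≤ Real.exp (2 * L * s) := Real.one_le_exp (by positivity)
    have hA0 : 0 ≤ A := by positivity
    have h4 := mul_le_mul_of_nonneg_left h1 hL.le
    have h5 := mul_le_mul_of_nonneg_left h3 hA0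
    linarith
  have hA0 : 0 ≤ A := by positivity
  have hcan : ∀ t, Real.exp (-(2 * L * t)) * Real.exp (2 * L * t) = 1 := fun t => by
    rw [← Real.exp_add]; simp
  let G : (ℝ →ᵇ E) → (ℝ →ᵇ E) := fun w =>
    BoundedContinuousFunction.ofNormedAddCommGroup
      (fun t => Real.exp (-(2 * L * t)) • J w (max t 0))
      (by have := hJ w; fun_prop) ((A + L * ‖w‖) / (2 * L)) (by
        intro t
        rcases le_total t 0 with h | h
        · rw [max_eq_right h]
          simp only [J, intervalIntegral.integral_same, smul_zero, norm_zero]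
          positivity
        · rw [max_eq_left h, norm_smul, Real.norm_eq_abs, Real.abs_exp]
          have := norm_integral_exp_le (l := 2 * L) (A := A + L * ‖w‖) (by positivity)
            (by positivity) _ (hint w) (hbound w) t h
          calc _ ≤ Real.exp (-(2 * L * t)) * ((A + L * ‖w‖) / (2 * L) * Real.exp (2 * L * t)) := by
                gcongr
            _ = _ := by linear_combination ((A + L * ‖w‖) / (2 * L)) * hcan t)
  have hG : ∀ w t, G w t = Real.exp (-(2 * L * t)) • J w (max t 0) := fun w t => rfl
  have hcontr : ContractingWith (1/2) G := by
    refine ⟨by norm_num, LipschitzWith.of_dist_le_mul fun w w' => ?_⟩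
    rw [dist_eq_norm, dist_eq_norm]
    rw [BoundedContinuousFunction.norm_le (by positivity)]
    intro t
    rw [BoundedContinuousFunction.sub_apply, hG, hG, ← smul_sub]
    rcases le_total t 0 with h | h
    · rw [max_eq_right h]
      simp only [J, intervalIntegral.integral_same, smul_zero, sub_zero, norm_zero]
      positivity
    · rw [max_eq_left h, norm_smul, Real.norm_eq_abs, Real.abs_exp]
      have h1 : J w t - J w' t = ∫ s in (0:ℝ)..t,
          (f (seg δ (Y w) (hY w) s) - f (seg δ (Y w') (hY w') s)) :=
        (intervalIntegral.integral_sub ((hint w).intervalIntegrable _ _)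
          ((hint w').intervalIntegrable _ _)).symm
      rw [h1]
      have := norm_integral_exp_le (l := 2 * L) (A := L * ‖w - w'‖) (by positivity)
        (by positivity) _ ((hint w).sub (hint w')) (fun s hs => by
          refine (hf _ _).trans ?_
          rw [mul_assoc]
          gcongr
          rw [ContinuousMap.norm_le _ (by positivity)]
          intro θ
          rw [ContinuousMap.sub_apply, seg_apply', seg_apply']
          have : Y w (s + θ.1) - Y w' (s + θ.1) =
              Real.exp (2 * L * (s + θ.1)) • (w - w') (s + θ.1) := by
            simp only [Y, BoundedContinuousFunction.sub_apply, smul_sub]; abel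
          rw [this, norm_smul, Real.norm_eq_abs, Real.abs_exp, mul_comm]
          gcongr
          · exact (w - w').norm_coe_le_norm _
          · linarith [θ.2.2]) t h
      calc _ ≤ Real.exp (-(2 * L * t)) * ((L * ‖w - w'‖) / (2 * L) * Real.exp (2 * L * t)) := by
            gcongr
            exact this
        _ = (L * ‖w - w'‖) / (2 * L) := by
            linear_combination ((L * ‖w - w'‖) / (2 * L)) * hcan t
        _ = 1 / 2 * ‖w - w'‖ := by field_simp
        _ = _ := by simp
  have : Nonempty (ℝ →ᵇ E) := ⟨0⟩
  set w := hcontr.fixedPoint with hw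
  have hfix : G w = w := hcontr.fixedPoint_isFixedPt
  refine ⟨Y w, hY w, fun t ht => ?_, fun t ht => ?_⟩
  · have : w t = 0 := by
      rw [← hfix, hG, max_eq_right ht]
      simp [J]
    simp [Y, this, min_eq_left ht]
  · have : w t = Real.exp (-(2 * L * t)) • J w t := by
      conv_lhs => rw [← hfix]
      rw [hG, max_eq_left ht]
    simp only [Y]
    rw [this, smul_smul, mul_comm, hcan, one_smul, min_eq_right ht]

lemma delay_exists' [CompleteSpace E] {L δ : ℝ} (hL : 0 < L)
    (f : C(Set.Icc (-δ) (0:ℝ), E) → E) (hf : ∀ a b, ‖f a - f b‖ ≤ L * ‖a - b‖)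
    (φ : ℝ → E) (hφ : Continuous φ) (hφ0 : HasDerivAt φ (f (seg δ φ hφ 0)) 0) :
    ∃ (y : ℝ → E) (hy : Continuous y), seg δ y hy 0 = seg δ φ hφ 0 ∧
      (∀ t, 0 ≤ t → HasDerivAt y (f (seg δ y hy t)) t) := by
  obtain ⟨y, hy, h1, h2⟩ := delay_exists hL f hf φ hφ
  have hseg : seg δ y hy 0 = seg δ φ hφ 0 := by
    ext1 θ
    rw [seg_apply', seg_apply']
    exact h1 _ (by linarith [θ.2.2])
  have hfc : Continuous f := by
    have : LipschitzWith ⟨L, hL.le⟩ f := LipschitzWith.of_dist_le_mul fun a b => by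
      rw [dist_eq_norm, dist_eq_norm]; exact hf a b
    exact this.continuous
  have hc : Continuous fun s => f (seg δ y hy s) := hfc.comp (seg_continuous _ _ _)
  have hd : ∀ t, HasDerivAt (fun t => φ 0 + ∫ s in (0:ℝ)..t, f (seg δ y hy s))
      (f (seg δ y hy t)) t := fun t =>
    (intervalIntegral.integral_hasDerivAt_right (hc.intervalIntegrable _ _)
      (hc.stronglyMeasurableAtFilter _ _) hc.continuousAt).const_add _
  refine ⟨y, hy, hseg, fun t ht => ?_⟩
  rcases ht.eq_or_lt with rfl | ht
  · have hl : HasDerivWithinAt y (f (seg δ y hy 0)) (Iic 0) 0 := by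
      rw [hseg]
      exact hφ0.hasDerivWithinAt.congr (fun s hs => h1 s hs) (h1 0 le_rfl)
    have hr : HasDerivWithinAt y (f (seg δ y hy 0)) (Ici 0) 0 :=
      (hd 0).hasDerivWithinAt.congr (fun s hs => h2 s hs) (h2 0 le_rfl)
    have := hl.union hr
    rwa [Iic_union_Ici, hasDerivWithinAt_univ] at this
  · refine (hd t).congr_of_eventuallyEq ?_
    filter_upwards [lt_mem_nhds ht] with s hs using h2 s hs.le

/-- One contraction step. -/
lemma delay_step [CompleteSpace E] {F : Type*} [NormedAddCommGroup F] {L δ a₁ a₂ T : ℝ}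
    (hL : 0 < L) (hδ : 0 ≤ δ) (ha₁ : 0 < a₁) (ha₂ : 0 < a₂)
    (g : C(Set.Icc (-δ) (0:ℝ), E) → F → E)
    (hgLip : ∀ φ ψ u v, ‖g φ u - g ψ v‖ ≤ L * (‖φ - ψ‖ + ‖u - v‖))
    (hGES : ∀ (x : ℝ → E) (hx : Continuous x),
        (∀ t, 0 ≤ t → HasDerivAt x (g (seg δ x hx t) 0) t) →
        ∀ t, 0 ≤ t → ‖x t‖ ≤ a₁ * ‖seg δ x hx 0‖ * Real.exp (-a₂ * t))
    (hT : δ ≤ T) (hTe : a₁ * Real.exp (-a₂ * (T - δ)) ≤ 1 / 2)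
    (v : ℝ → F) {V : ℝ} (hV : ∀ s, 0 ≤ s → s ≤ T → ‖v s‖ ≤ V)
    (x : ℝ → E) (hx : Continuous x)
    (hxd : ∀ t, 0 ≤ t → HasDerivAt x (g (seg δ x hx t) (v t)) t) :
    ‖seg δ x hx T‖ ≤ 1 / 2 * ‖seg δ x hx 0‖ + (1 / 2 + 2 * gK L δ T) * V := by
  have hT0 : 0 ≤ T := hδ.trans hT
  have hV0 : 0 ≤ V := (norm_nonneg _).trans (hV 0 le_rfl hT0)
  set ε := 1 / (2 * L) with hε
  have hε0 : 0 < ε := by positivity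
  have hLε : L * ε = 1 / 2 := by rw [hε]; field_simp
  let h : ℝ → ℝ := fun t => ε * Real.sin (t / ε)
  have hhc : Continuous h := by fun_prop
  have hhd : HasDerivAt h 1 0 := by
    have := (((hasDerivAt_id (0:ℝ)).div_const ε).sin).const_mul ε
    refine this.congr_deriv ?_
    simp; field_simp
  have hhb : ∀ t, |h t| ≤ ε := fun t => by
    simp only [h, abs_mul, abs_of_pos hε0]
    exact mul_le_of_le_one_right hε0.le (Real.abs_sin_le_one _)
  have hφc : ∀ c : E, Continuous fun t => x t + h t • c := fun c => by fun_prop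
  have hseg : ∀ c c' : E, ‖seg δ _ (hφc c) 0 - seg δ _ (hφc c') 0‖ ≤ ε * ‖c - c'‖ := by
    intro c c'
    rw [ContinuousMap.norm_le _ (by positivity)]
    intro θ
    rw [ContinuousMap.sub_apply, seg_apply', seg_apply', add_sub_add_left_eq_sub, ← smul_sub,
      norm_smul]
    gcongr
    exact hhb _
  have hseg0 : seg δ _ (hφc 0) 0 = seg δ x hx 0 := by
    ext1 θ
    simp [seg_apply']
  have hcon : ContractingWith (1/2)
      (fun c : E => g (seg δ _ (hφc c) 0) 0 - g (seg δ x hx 0) (v 0)) := by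
    refine ⟨by norm_num, LipschitzWith.of_dist_le_mul fun c c' => ?_⟩
    rw [dist_eq_norm, dist_eq_norm, sub_sub_sub_cancel_right]
    refine (hgLip _ _ _ _).trans ?_
    rw [sub_zero, norm_zero, add_zero]
    calc _ ≤ L * (ε * ‖c - c'‖) := by gcongr; exact hseg c c'
      _ = 1 / 2 * ‖c - c'‖ := by rw [← mul_assoc, hLε]
      _ = _ := by simp
  have : Nonempty E := ⟨0⟩
  obtain ⟨c, hc⟩ : ∃ c : E, g (seg δ _ (hφc c) 0) 0 - g (seg δ x hx 0) (v 0) = c :=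
    ⟨_, hcon.fixedPoint_isFixedPt⟩
  have hdist : ‖seg δ _ (hφc c) 0 - seg δ x hx 0‖ ≤ ε * ‖c‖ := by
    have := hseg c 0
    rwa [hseg0, sub_zero] at this
  have hcb : ε * ‖c‖ ≤ V := by
    have h1 := hgLip (seg δ _ (hφc c) 0) (seg δ x hx 0) 0 (v 0)
    rw [hc, zero_sub, norm_neg] at h1
    have h2 : L * (‖seg δ _ (hφc c) 0 - seg δ x hx 0‖ + ‖v 0‖) ≤ L * (ε * ‖c‖ + V) := by
      gcongr
      exact hV 0 le_rfl hT0
    have h3 : L * (ε * ‖c‖ + V) = 1 / 2 * ‖c‖ + L * V := by rw [← hLε]; ring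
    have h4 : ‖c‖ ≤ 2 * L * V := by linarith
    calc ε * ‖c‖ ≤ ε * (2 * L * V) := by gcongr
      _ = 2 * (L * ε) * V := by ring
      _ = V := by rw [hLε]; ring
  have hφd : HasDerivAt (fun t => x t + h t • c) (g (seg δ _ (hφc c) 0) 0) 0 := by
    refine ((hxd 0 le_rfl).add (hhd.smul_const c)).congr_deriv ?_
    rw [one_smul, add_comm]
    exact (sub_eq_iff_eq_add.1 hc).symm
  obtain ⟨y, hy, hy0, hyd⟩ := delay_exists' hL (fun a => g a 0)
    (fun a b => by simpa using hgLip a b 0 0) _ (hφc c) hφd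
  have hyb := hGES y hy hyd
  have hdseg : ∀ t, seg δ (fun t => y t - x t) (hy.sub hx) t = seg δ y hy t - seg δ x hx t :=
    fun t => rfl
  have hgr := delay_gronwall (T := T) hL hδ hT0 le_rfl hV0 hV0 (fun t => y t - x t) _ (hy.sub hx)
    (fun t ht => (hyd t ht).sub (hxd t ht))
    (fun t ht hts => by
      refine (hgLip _ _ _ _).trans ?_
      rw [hdseg, zero_sub, norm_neg]
      gcongr
      exact hV t ht hts)
    (by rw [hdseg, hy0]; exact hdist.trans hcb)
  have hy0b : ‖seg δ y hy 0‖ ≤ ‖seg δ x hx 0‖ + V := by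
    have h1 := norm_sub_norm_le (seg δ y hy 0) (seg δ x hx 0)
    rw [hy0] at h1 ⊢
    linarith [hdist, hcb]
  have hK := gK_pos (δ := δ) hL hT0
  apply seg_norm_le _ _ _ _ (by positivity)
  intro r hr1 hr2
  have h1 := hgr r (by linarith) hr2
  have h2 := hyb r (by linarith)
  have h3 : a₁ * ‖seg δ y hy 0‖ * Real.exp (-a₂ * r) ≤ 1 / 2 * (‖seg δ x hx 0‖ + V) := by
    calc _ = (a₁ * Real.exp (-a₂ * r)) * ‖seg δ y hy 0‖ := by ring
      _ ≤ (a₁ * Real.exp (-a₂ * (T - δ))) * ‖seg δ y hy 0‖ := by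
        gcongr ?_ * _
        gcongr a₁ * Real.exp ?_
        nlinarith
      _ ≤ _ := by gcongr
  have h4 : ‖x r‖ ≤ ‖y r‖ + ‖y r - x r‖ := by
    have := norm_sub_norm_le (x r) (y r)
    rw [norm_sub_rev] at this
    linarith
  linarith

end helpers

/-- Lemma 2: a globally Lipschitz retarded system `ẋ(t) = g(x_t, v(t))` whose zero-input
system is globally exponentially stable is input-to-state stable. -/
theorem GES_zero_input_implies_ISS
    (n p : ℕ) (δ : ℝ) (hδ : 0 ≤ δ)
    (g : C(Set.Icc (-δ) (0:ℝ), EuclideanSpace ℝ (Fin n)) → EuclideanSpace ℝ (Fin p) →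
      EuclideanSpace ℝ (Fin n))
    (hg0 : g 0 0 = 0)
    (hgLip : ∃ L : ℝ, 0 < L ∧
      ∀ φ ψ u v, ‖g φ u - g ψ v‖ ≤ L * (‖φ - ψ‖ + ‖u - v‖))
    -- global exponential stability of the zero-input system:
    (hGES : ∃ a₁ a₂ : ℝ, 0 < a₁ ∧ 0 < a₂ ∧
      ∀ (x : ℝ → EuclideanSpace ℝ (Fin n)) (hx : Continuous x),
        (∀ t, 0 ≤ t → HasDerivAt x (g (seg δ x hx t) 0) t) →
        ∀ t, 0 ≤ t → ‖x t‖ ≤ a₁ * ‖seg δ x hx 0‖ * Real.exp (-a₂ * t)) :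
    -- input-to-state stability:
    ∃ β : ℝ → ℝ → ℝ, ∃ γ : ℝ → ℝ, ClassKL β ∧ ClassK γ ∧
      ∀ v : ℝ → EuclideanSpace ℝ (Fin p), Continuous v →
        (∃ M : ℝ, ∀ s, 0 ≤ s → ‖v s‖ ≤ M) →
        ∀ (x : ℝ → EuclideanSpace ℝ (Fin n)) (hx : Continuous x),
          (∀ t, 0 ≤ t → HasDerivAt x (g (seg δ x hx t) (v t)) t) →
          ∀ t, 0 ≤ t → ‖x t‖ ≤
            β ‖seg δ x hx 0‖ t + γ (sSup ((fun s => ‖v s‖) '' Set.Icc 0 t)) := by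
  obtain ⟨L, hL, hgLip⟩ := hgLip
  obtain ⟨a₁, a₂, ha₁, ha₂, hGES⟩ := hGES
  obtain ⟨T, hTδ, hT0, hTe⟩ : ∃ T : ℝ, δ ≤ T ∧ 0 < T ∧
      a₁ * Real.exp (-a₂ * (T - δ)) ≤ 1 / 2 := by
    have hlim : Tendsto (fun T : ℝ => a₁ * Real.exp (-a₂ * (T - δ))) atTop (𝓝 (a₁ * 0)) := by
      refine Tendsto.const_mul _ (Real.tendsto_exp_atBot.comp ?_)
      exact (tendsto_atTop_add_const_right _ (-δ) tendsto_id).const_mul_atTop_of_neg (by linarith)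
    rw [mul_zero] at hlim
    have h1 := hlim.eventually (ge_mem_nhds (show (0:ℝ) < 1 / 2 by norm_num))
    obtain ⟨T, h⟩ := (h1.and ((eventually_ge_atTop δ).and (eventually_gt_atTop 0))).exists
    exact ⟨T, h.2.1, h.2.2, h.1⟩
  set K := gK L δ T with hKdef
  have hK : 0 < K := gK_pos hL hT0.le
  set C := 1 / 2 + 2 * K with hC
  have hC0 : 0 < C := by positivity
  have hl2 : 0 < Real.log 2 / T := div_pos (Real.log_pos (by norm_num)) hT0
  refine ⟨fun s t => 2 * K * s * Real.exp (-(Real.log 2 / T) * t),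
    fun s => K * (2 * C + 1) * s, ⟨fun t ht => ⟨by fun_prop, ?_, by simp⟩, fun s hs => ⟨?_, ?_⟩⟩,
    ⟨by fun_prop, ?_, by simp⟩, ?_⟩
  · intro a _ b _ hab
    have := Real.exp_pos (-(Real.log 2 / T) * t)
    dsimp only
    gcongr
  · intro a _ b _ hab
    have : -(Real.log 2 / T) * b ≤ -(Real.log 2 / T) * a := by nlinarith
    dsimp only
    gcongr
  · have : Tendsto (fun t : ℝ => 2 * K * s * Real.exp (-(Real.log 2 / T) * t)) atTop
        (𝓝 (2 * K * s * 0)) := by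
      refine Tendsto.const_mul _ (Real.tendsto_exp_atBot.comp ?_)
      exact tendsto_id.const_mul_atTop_of_neg (by linarith)
    simpa using this
  · intro a _ b _ hab
    dsimp only
    have : 0 < K * (2 * C + 1) := by positivity
    gcongr
  intro v hv _ x hx hxd t ht
  set V := sSup ((fun s => ‖v s‖) '' Set.Icc 0 t) with hVdef
  have hVb : ∀ s, 0 ≤ s → s ≤ t → ‖v s‖ ≤ V := fun s h1 h2 =>
    le_csSup (isCompact_Icc.bddAbove_image (hv.norm.continuousOn)) ⟨s, ⟨h1, h2⟩, rfl⟩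
  have hV0 : 0 ≤ V := (norm_nonneg _).trans (hVb 0 le_rfl ht)
  have hshift : ∀ s, 0 ≤ s → ∀ r, 0 ≤ r → HasDerivAt (fun r => x (s + r))
      (g (seg δ (fun r => x (s + r)) (hx.comp (continuous_const.add continuous_id)) r)
        (v (s + r))) r := by
    intro s hs r hr
    rw [seg_shift δ x hx s r]
    exact (hxd (s + r) (by linarith)).comp_const_add s r
  have hind : ∀ k : ℕ, k * T ≤ t →
      ‖seg δ x hx (k * T)‖ ≤ (1 / 2) ^ k * ‖seg δ x hx 0‖ + 2 * C * V := by
    intro k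
    induction k with
    | zero =>
      intro _
      have : 0 ≤ 2 * C * V := by positivity
      simpa using this
    | succ k ih =>
      intro hk
      push_cast at hk
      have hkT : 0 ≤ (k : ℝ) * T := by positivity
      have h1 := ih (by linarith)
      have h2 := delay_step hL hδ ha₁ ha₂ g hgLip hGES hTδ hTe (fun r => v (k * T + r)) (V := V)
        (fun s h1 h2 => hVb _ (by linarith) (by linarith)) (fun r => x (k * T + r)) _
        (hshift (k * T) hkT)
      rw [seg_shift δ x hx, seg_shift δ x hx, add_zero] at h2
      have h3 : ((k + 1 : ℕ) : ℝ) * T = k * T + T := by push_cast; ring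
      rw [h3, pow_succ]
      rw [← hKdef, ← hC] at h2
      linarith
  set k := ⌊t / T⌋₊ with hk
  have hk1 : (k : ℝ) * T ≤ t := by
    have := Nat.floor_le (div_nonneg ht hT0.le)
    rwa [le_div_iff₀ hT0] at this
  have hk2 : t < (k + 1) * T := by
    have := Nat.lt_floor_add_one (t / T)
    rwa [div_lt_iff₀ hT0] at this
  have hkT : 0 ≤ (k : ℝ) * T := by positivity
  have hgr := delay_gronwall (T := T) (S := t - k * T) hL hδ (by linarith) (by linarith) hV0
    (norm_nonneg (seg δ x hx (k * T))) (fun r => x (k * T + r)) _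
    (hx.comp (continuous_const.add continuous_id)) (hshift (k * T) hkT)
    (fun r h1 h2 => by
      have := hgLip (seg δ (fun r => x (k * T + r))
        (hx.comp (continuous_const.add continuous_id)) r) 0 (v (k * T + r)) 0
      rw [hg0, sub_zero, sub_zero, sub_zero] at this
      refine this.trans ?_
      gcongr
      exact hVb _ (by linarith) (by linarith))
    (by rw [seg_shift δ x hx, add_zero]) (t - k * T) (by linarith) le_rfl
  simp only [add_sub_cancel] at hgr
  have hpow : ((1:ℝ) / 2) ^ k ≤ 2 * Real.exp (-(Real.log 2 / T) * t) := by
    have h1 : ((1:ℝ) / 2) ^ k = 2 * Real.exp (-(Real.log 2) * (k + 1)) := by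
      have : -(Real.log 2) * ((k:ℝ) + 1) = ((k + 1 : ℕ) : ℝ) * (- Real.log 2) := by
        push_cast; ring
      rw [this, Real.exp_nat_mul, Real.exp_neg, Real.exp_log (by norm_num), pow_succ]
      norm_num
      ring
    rw [h1]
    gcongr 2 * Real.exp ?_
    have : -(Real.log 2 / T) * t = -(Real.log 2) * (t / T) := by ring
    rw [this]
    have h3 : t / T ≤ k + 1 := (Nat.lt_floor_add_one (t / T)).le
    have : 0 < Real.log 2 := Real.log_pos (by norm_num)
    nlinarith
  rw [← hKdef] at hgr
  calc ‖x t‖ ≤ K * (‖seg δ x hx (k * T)‖ + V) := hgr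
    _ ≤ K * (((2 * Real.exp (-(Real.log 2 / T) * t)) * ‖seg δ x hx 0‖ + 2 * C * V) + V) := by
      gcongr
      refine (hind k hk1).trans ?_
      gcongr
    _ = _ := by ring
end

section
/- Let n, p ∈ ℕ, δ ≥ 0, d ≥ 0, and let g : C([−δ,0],ℝⁿ) × C([−d,0],ℝᵖ) → ℝⁿ. Suppose there exist a continuously differentiable V : ℝⁿ → [0,∞), functions α₁, α₂ of class K_∞, real constants a > b > 0, and a class-K function γ such that α₁(‖x‖) ≤ V(x) ≤ α₂(‖x‖) for all x ∈ ℝⁿ, and such that along every solution the Lyapunov–Halanay estimate holds: for every continuous v : [−d,∞) → ℝᵖ and every continuous x : [−δ,∞) → ℝⁿ differentiable on [0,∞) with x′(t) = g(x_t, v_t) for all t ≥ 0, one has (d/dt)V(x(t)) ≤ −a·V(x(t)) + b·max_{θ∈[−δ,0]} V(x(t+θ)) + γ(‖v_t‖_c) for all t ≥ 0. Then the retarded system ẋ(t) = g(x_t, v_t) is input-to-state stable: there exist a class-KL function β and a class-K function γ̂ such that every such solution satisfies ‖x(t)‖ ≤ β(‖x₀‖_c, t) + γ̂( sup_{0≤s≤t}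 ‖v_s‖_c ) for all t ≥ 0. -/
open Set Filter Topology

/-- A function of class K∞: class K and unbounded. -/
def ClassKInf (γ : ℝ → ℝ) : Prop :=
  ClassK γ ∧ Filter.Tendsto γ Filter.atTop Filter.atTop

theorem halanay_aux (W : ℝ → ℝ) (hW : Continuous W) (δ a b l G M T : ℝ) (hδ : 0 ≤ δ) (hb : 0 < b)
    (hab : b < a) (hl : 0 < l) (hl2 : b * Real.exp (l * δ) + l < a) (hM : 0 ≤ M) (hG : 0 ≤ G)
    (hT : 0 ≤ T)
    (hd : ∀ t, 0 ≤ t → DifferentiableAt ℝ W t)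
    (hW0 : ∀ t, -δ ≤ t → t ≤ 0 → W t ≤ M)
    (hder : ∀ t, 0 ≤ t → t ≤ T →
      deriv W t ≤ -a * W t + b * sSup (W '' Set.Icc (t - δ) t) + G) :
    W T ≤ M * Real.exp (-l * T) + G / (a - b) := by
  have hab' : 0 < a - b := by linarith
  have key : ∀ ε : ℝ, 0 < ε → W T < (M + ε) * Real.exp (-l * T) + (G / (a - b) + ε) := by
    intro ε hε
    set h : ℝ → ℝ := fun t => (M + ε) * Real.exp (-l * t) + (G / (a - b) + ε) with hh
    have hGab : 0 ≤ G / (a - b) := by positivity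
    have hhc : Continuous h := by rw [hh]; fun_prop
    have hanti : ∀ s t, s ≤ t → h t ≤ h s := by
      intro s t hst
      have h1 : Real.exp (-l * t) ≤ Real.exp (-l * s) := Real.exp_le_exp.2 (by nlinarith)
      have := mul_le_mul_of_nonneg_left h1 (by linarith : 0 ≤ M + ε)
      simp only [hh]; linarith
    have hh0 : h 0 = M + ε + (G / (a - b) + ε) := by simp [hh]
    have hpast : ∀ t, -δ ≤ t → t ≤ 0 → W t < h t := by
      intro t h1 h2
      have := hW0 t h1 h2
      have := hanti t 0 h2
      linarith
    by_contra hcon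
    have hcon : h T ≤ W T := not_lt.1 hcon
    set S : Set ℝ := Set.Icc 0 T ∩ {t | h t ≤ W t} with hS
    have hSc : IsCompact S := isCompact_Icc.inter_right (isClosed_le hhc hW)
    have hSne : S.Nonempty := ⟨T, ⟨hT, le_rfl⟩, hcon⟩
    have ht1 : sInf S ∈ S := hSc.sInf_mem hSne
    set t1 := sInf S with ht1def
    have ht1pos : 0 < t1 := by
      rcases ht1.1.1.lt_or_eq with h1 | h1
      · exact h1
      · exfalso
        have h2 := hpast 0 (by linarith) le_rfl
        have h3 : h t1 ≤ W t1 := ht1.2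
        rw [← h1] at h3
        linarith
    have hbefore : ∀ t, -δ ≤ t → t < t1 → W t < h t := by
      intro t h1 h2
      rcases le_total t 0 with h3 | h3
      · exact hpast t h1 h3
      · by_contra hc
        have : t ∈ S := ⟨⟨h3, h2.le.trans ht1.1.2⟩, not_lt.1 hc⟩
        have := csInf_le hSc.bddBelow this
        linarith
    have hev : ∀ᶠ t in 𝓝[<] t1, W t < h t := by
      filter_upwards [Ioo_mem_nhdsLT ht1pos] with t ht
      exact hbefore t (by linarith [ht.1]) ht.2
    have heq : W t1 = h t1 := by
      refine le_antisymm ?_ ht1.2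
      refine le_of_tendsto_of_tendsto (hW.continuousAt.continuousWithinAt (s := Set.Iio t1))
        (hhc.continuousAt.continuousWithinAt) ?_
      filter_upwards [hev] with t ht using ht.le
    have hhd : HasDerivAt h ((M + ε) * (Real.exp (-l * t1) * (-l * 1))) t1 := by
      have := (((hasDerivAt_id t1).const_mul (-l)).exp.const_mul (M + ε)).add_const
        (G / (a - b) + ε)
      exact this
    have hWd := (hd t1 ht1pos.le).hasDerivAt
    have hsub := hWd.sub hhd
    have hge : 0 ≤ deriv W t1 - (M + ε) * (Real.exp (-l * t1) * (-l * 1)) := by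
      have h1 := (hasDerivAt_iff_tendsto_slope.1 hsub).mono_left
        (nhdsWithin_mono t1 (show Set.Iio t1 ⊆ {t1}ᶜ from fun t ht => ne_of_lt ht))
      refine ge_of_tendsto h1 ?_
      filter_upwards [hev, self_mem_nhdsWithin] with t ht ht'
      have ht' : t < t1 := ht'
      rw [slope_def_field]
      apply div_nonneg_of_nonpos
      · simp only [Pi.sub_apply]; linarith
      · linarith
    have hsup : sSup (W '' Set.Icc (t1 - δ) t1) ≤ h (t1 - δ) := by
      refine csSup_le ⟨W t1, t1, ⟨by linarith, le_rfl⟩, rfl⟩ ?_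
      rintro _ ⟨θ, hθ, rfl⟩
      have h2 := hanti _ _ hθ.1
      rcases hθ.2.lt_or_eq with h1 | h1
      · have := hbefore θ (by linarith [hθ.1]) h1
        linarith
      · rw [h1] at h2 ⊢
        linarith
    have hd1 := hder t1 ht1pos.le ht1.1.2
    have hb1 := mul_le_mul_of_nonneg_left hsup hb.le
    have hexp : Real.exp (-l * (t1 - δ)) = Real.exp (-l * t1) * Real.exp (l * δ) := by
      rw [← Real.exp_add]; congr 1; ring
    have hGe : (a - b) * (G / (a - b)) = G := by field_simp
    rw [heq] at hd1
    simp only [hh, hexp] at hd1 hb1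
    have hpos : 0 < (M + ε) * Real.exp (-l * t1) := by positivity
    have hfin := mul_lt_mul_of_pos_left hl2 hpos
    have := mul_pos hab' hε
    generalize Real.exp (-l * t1) = E at *
    generalize Real.exp (l * δ) = F at *
    generalize G / (a - b) = Q at *
    nlinarith
  have hlim : Tendsto (fun ε : ℝ => (M + ε) * Real.exp (-l * T) + (G / (a - b) + ε)) (𝓝[>] 0)
      (𝓝 ((M + 0) * Real.exp (-l * T) + (G / (a - b) + 0))) := by
    apply tendsto_nhdsWithin_of_tendsto_nhds
    exact Continuous.tendsto (by fun_prop) 0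
  simp only [add_zero] at hlim
  refine ge_of_tendsto hlim ?_
  filter_upwards [self_mem_nhdsWithin] with ε hε using (key ε hε).le

theorem classK_nonneg {γ : ℝ → ℝ} (h : ClassK γ) {s : ℝ} (hs : 0 ≤ s) : 0 ≤ γ s := by
  have := h.2.1.monotoneOn (Set.mem_Ici.2 le_rfl) (Set.mem_Ici.2 hs) hs
  rwa [h.2.2] at this

theorem classKInf_inverse {α : ℝ → ℝ} (hα : ClassKInf α) :
    ∃ ψ : ℝ → ℝ, Continuous ψ ∧ StrictMono ψ ∧ ψ 0 = 0 ∧ ∀ s, 0 ≤ s → ψ (α s) = s := by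
  obtain ⟨⟨hc, hm, h0⟩, ht⟩ := hα
  set f : ℝ → ℝ := fun s => α (max s 0) + min s 0 with hf
  have hfc : Continuous f := by
    have : Continuous (fun s : ℝ => α (max s 0)) :=
      hc.comp_continuous (by fun_prop) (fun s => Set.mem_Ici.2 (le_max_right _ _))
    exact this.add (by fun_prop)
  have hpos : ∀ s, 0 ≤ s → f s = α s := by
    intro s hs; simp [hf, hs]
  have hneg : ∀ s, s ≤ 0 → f s = s := by
    intro s hs; simp [hf, hs, h0]
  have hfm : StrictMono f := by
    intro s t hst
    rcases le_total 0 s with h1 | h1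
    · rw [hpos s h1, hpos t (h1.trans hst.le)]
      exact hm h1 (h1.trans hst.le) hst
    · rcases le_total t 0 with h2 | h2
      · rw [hneg s h1, hneg t h2]; exact hst
      · rw [hneg s h1, hpos t h2]
        rcases h2.lt_or_eq with h3 | h3
        · have := hm (Set.mem_Ici.2 le_rfl) (Set.mem_Ici.2 h2) h3
          linarith
        · rw [← h3] at hst ⊢; linarith
  have htop : Tendsto f atTop atTop := by
    refine ht.congr' ?_
    filter_upwards [eventually_ge_atTop 0] with s hs using (hpos s hs).symm
  have hbot : Tendsto f atBot atBot := by
    refine tendsto_id.congr' ?_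
    filter_upwards [eventually_le_atBot 0] with s hs using (hneg s hs).symm
  have hsurj : Function.Surjective f := hfc.surjective htop hbot
  let e := hfm.orderIsoOfSurjective f hsurj
  have he : ∀ s, e s = f s := fun s => rfl
  refine ⟨e.symm, e.symm.continuous, e.symm.strictMono, ?_, ?_⟩
  · rw [OrderIso.symm_apply_eq, he, hneg 0 le_rfl]
  · intro s hs
    rw [OrderIso.symm_apply_eq, he, hpos s hs]

/-- Lemma 3: a Lyapunov–Halanay dissipation estimate
`V̇ ≤ -a V + b max_{[-δ,0]} V + γ(‖v_t‖_c)` with `a > b > 0` implies input-to-state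
stability of the retarded system `ẋ(t) = g(x_t, v_t)`. -/
theorem lyapunov_halanay_ISS
    (n p : ℕ) (δ d a b : ℝ) (hδ : 0 ≤ δ) (hd : 0 ≤ d) (hb : 0 < b) (hab : b < a)
    (g : C(Set.Icc (-δ) (0:ℝ), EuclideanSpace ℝ (Fin n)) →
      C(Set.Icc (-d) (0:ℝ), EuclideanSpace ℝ (Fin p)) → EuclideanSpace ℝ (Fin n))
    (V : EuclideanSpace ℝ (Fin n) → ℝ) (hV : ContDiff ℝ 1 V)
    (hVnonneg : ∀ x, 0 ≤ V x)
    (α₁ α₂ : ℝ → ℝ) (hα₁ : ClassKInf α₁) (hα₂ : ClassKInf α₂)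
    (hsandwich : ∀ x : EuclideanSpace ℝ (Fin n), α₁ ‖x‖ ≤ V x ∧ V x ≤ α₂ ‖x‖)
    (γ : ℝ → ℝ) (hγ : ClassK γ)
    -- the Lyapunov–Halanay estimate along every solution:
    (hLH : ∀ (v : ℝ → EuclideanSpace ℝ (Fin p)) (hv : Continuous v)
        (x : ℝ → EuclideanSpace ℝ (Fin n)) (hx : Continuous x),
      (∀ t, 0 ≤ t → HasDerivAt x (g (seg δ x hx t) (seg d v hv t)) t) →
      ∀ t, 0 ≤ t →
        deriv (fun s => V (x s)) t ≤
          -a * V (x t) + b * sSup ((fun θ => V (x θ)) '' Set.Icc (t - δ) t) +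
            γ ‖seg d v hv t‖) :
    -- input-to-state stability:
    ∃ β : ℝ → ℝ → ℝ, ∃ γhat : ℝ → ℝ, ClassKL β ∧ ClassK γhat ∧
      ∀ (v : ℝ → EuclideanSpace ℝ (Fin p)) (hv : Continuous v)
        (x : ℝ → EuclideanSpace ℝ (Fin n)) (hx : Continuous x),
        (∀ t, 0 ≤ t → HasDerivAt x (g (seg δ x hx t) (seg d v hv t)) t) →
        ∀ t, 0 ≤ t → ‖x t‖ ≤
          β ‖seg δ x hx 0‖ t + γhat (sSup ((fun s => ‖seg d v hv s‖) '' Set.Icc 0 t)) := by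
  obtain ⟨ψ, hψc, hψm, hψ0, hψ⟩ := classKInf_inverse hα₁
  have hab' : 0 < a - b := by linarith
  obtain ⟨l, hl, hl2⟩ : ∃ l : ℝ, 0 < l ∧ b * Real.exp (l * δ) + l < a := by
    have hlim : Tendsto (fun l : ℝ => b * Real.exp (l * δ) + l) (𝓝[>] 0)
        (𝓝 (b * Real.exp (0 * δ) + 0)) := by
      apply tendsto_nhdsWithin_of_tendsto_nhds
      exact Continuous.tendsto (by fun_prop) 0
    have h1 := hlim.eventually_lt_const (u := a) (by simpa using hab)
    obtain ⟨l, h2, h3⟩ := (h1.and self_mem_nhdsWithin).exists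
    exact ⟨l, h3, h2⟩
  refine ⟨fun s t => ψ (2 * (α₂ s * Real.exp (-l * t))), fun s => ψ (2 * (γ s / (a - b))),
    ⟨?_, ?_⟩, ⟨?_, ?_, ?_⟩, ?_⟩
  · intro t ht
    refine ⟨?_, ?_, ?_⟩
    · exact hψc.comp_continuousOn
        (continuousOn_const.mul (hα₂.1.1.mul continuousOn_const))
    · intro s hs s' hs' hss
      apply hψm
      have := mul_lt_mul_of_pos_right (hα₂.1.2.1 hs hs' hss) (Real.exp_pos (-l * t))
      linarith
    · simp [hα₂.1.2.2, hψ0]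
  · intro s hs
    have hα := classK_nonneg hα₂.1 hs
    constructor
    · intro t _ t' _ htt
      apply hψm.monotone
      have h1 : Real.exp (-l * t') ≤ Real.exp (-l * t) := Real.exp_le_exp.2 (by nlinarith)
      have := mul_le_mul_of_nonneg_left h1 hα
      linarith
    · have h1 : Tendsto (fun t : ℝ => Real.exp (-l * t)) atTop (𝓝 0) :=
        Real.tendsto_exp_atBot.comp
          (tendsto_id.const_mul_atTop_of_neg (by linarith : -l < 0))
      have h2 := (hψc.tendsto _).comp ((h1.const_mul (α₂ s)).const_mul 2)
      simp only [mul_zero, hψ0] at h2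
      exact h2
  · exact hψc.comp_continuousOn (continuousOn_const.mul (hγ.1.div_const _))
  · intro s hs s' hs' hss
    apply hψm
    have := div_lt_div_of_pos_right (hγ.2.1 hs hs' hss) hab'
    linarith
  · simp [hγ.2.2, hψ0]
  · intro v hv x hx hsol t ht
    set S := sSup ((fun s => ‖seg d v hv s‖) '' Set.Icc 0 t) with hS
    have hbdd : BddAbove ((fun s => ‖seg d v hv s‖) '' Set.Icc 0 t) := by
      obtain ⟨C, hC⟩ := (isCompact_Icc (a := -d) (b := t)).exists_bound_of_continuousOn
        hv.continuousOn
      refine ⟨max C 0, ?_⟩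
      rintro _ ⟨s, hs, rfl⟩
      refine (ContinuousMap.norm_le _ (le_max_right _ _)).2 fun θ => ?_
      exact (hC (s + θ.1) ⟨by linarith [hs.1, θ.2.1], by linarith [hs.2, θ.2.2]⟩).trans
        (le_max_left _ _)
    have hle : ∀ s, 0 ≤ s → s ≤ t → ‖seg d v hv s‖ ≤ S := fun s h1 h2 =>
      le_csSup hbdd ⟨s, ⟨h1, h2⟩, rfl⟩
    have hS0 : 0 ≤ S := (norm_nonneg _).trans (hle 0 le_rfl ht)
    have hM := classK_nonneg hα₂.1 (norm_nonneg (seg δ x hx 0))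
    have hG := classK_nonneg hγ hS0
    have hmain := halanay_aux (fun s => V (x s)) (hV.continuous.comp hx) δ a b l (γ S)
      (α₂ ‖seg δ x hx 0‖) t hδ hb hab hl hl2 hM hG ht
      (fun s hs => ((hV.differentiable one_ne_zero) (x s)).comp s (hsol s hs).differentiableAt)
      (fun s h1 h2 => by
        refine (hsandwich (x s)).2.trans ?_
        apply hα₂.1.2.1.monotoneOn (Set.mem_Ici.2 (norm_nonneg _)) (Set.mem_Ici.2 (norm_nonneg _))
        have := (seg δ x hx 0).norm_coe_le_norm ⟨s, h1, h2⟩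
        simpa [seg] using this)
      (fun s h1 h2 => by
        have h3 := hLH v hv x hx hsol s h1
        have h4 := hγ.2.1.monotoneOn (Set.mem_Ici.2 (norm_nonneg _)) (Set.mem_Ici.2 hS0)
          (hle s h1 h2)
        linarith)
    have h5 := (hsandwich (x t)).1.trans hmain
    have h6 := hψm.monotone h5
    rw [hψ _ (norm_nonneg _)] at h6
    refine h6.trans ?_
    have hA : 0 ≤ α₂ ‖seg δ x hx 0‖ * Real.exp (-l * t) := by positivity
    have hB : 0 ≤ γ S / (a - b) := by positivity
    show _ ≤ ψ (2 * (α₂ ‖seg δ x hx 0‖ * Real.exp (-l * t))) + ψ (2 * (γ S / (a - b)))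
    generalize α₂ ‖seg δ x hx 0‖ * Real.exp (-l * t) = A at *
    generalize γ S / (a - b) = B at *
    have hA' : 0 ≤ ψ (2 * A) := by rw [← hψ0]; exact hψm.monotone (by linarith)
    have hB' : 0 ≤ ψ (2 * B) := by rw [← hψ0]; exact hψm.monotone (by linarith)
    rcases le_total A B with h | h
    · have := hψm.monotone (by linarith : A + B ≤ 2 * B)
      linarith
    · have := hψm.monotone (by linarith : A + B ≤ 2 * A)
      linarith
end
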